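/- arXiv:2202.05564 — 4 statements merged into one kernel-verified Lean document; each statement's English description precedes it below -/
import Mathlib

section
/- Let N_h, N_v be positive integers, let l_h, l_v, c > 0 and θ, φ, f^u, f^d ∈ ℝ. For a frequency f ∈ ℝ define the horizontal steering vector a_h(f) ∈ ℂ^{N_h} with k-th entry exp(2πi·(l_h f/c)·k·cosθ·cosφ) for k = 0,…,N_h−1, the vertical steering vector a_v(f) ∈ ℂ^{N_v} with k-th entry exp(2πi·(l_v f/c)·k·cosθ) for k = 0,…,N_v−1, and the steering vector α(f) = a_h(f) ⊗ a_v(f) ∈ ℂ^{N_h N_v}. Define the diagonal rotation matrices R_h ∈ ℂ^{N_h×N_h} with k-th diagonal entry exp(2πi·(l_h(f^d−f^u)/c)·k·cosθ·cosφ) and R_v ∈ ℂ^{N_v×N_v} with k-th diagonal entry exp(2πi·(l_v(f^d−f^u)/c)·k·cosθ). Then α(f^d) = (R_h ⊗ R_v)·α(f^u). -/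
open Matrix Complex Real Kronecker

/-- the downlink steering vector of a uniform planar array is obtained
from the uplink steering vector by the Kronecker product of the horizontal and
vertical rotation matrices. -/
theorem stmt_0 (Nh Nv : ℕ) (hNh : 0 < Nh) (hNv : 0 < Nv)
    (lh lv c θ φ fu fd : ℝ) (hlh : 0 < lh) (hlv : 0 < lv) (hc : 0 < c)
    (ah : ℝ → Fin Nh → ℂ) (av : ℝ → Fin Nv → ℂ)
    (α : ℝ → (Fin Nh × Fin Nv) → ℂ)
    (hah : ∀ f k, ah f k =
      Complex.exp (2 * (Real.pi : ℂ) * Complex.I * ((lh * f / c : ℝ) : ℂ) *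
        ((k : ℕ) : ℂ) * ((Real.cos θ : ℝ) : ℂ) * ((Real.cos φ : ℝ) : ℂ)))
    (hav : ∀ f k, av f k =
      Complex.exp (2 * (Real.pi : ℂ) * Complex.I * ((lv * f / c : ℝ) : ℂ) *
        ((k : ℕ) : ℂ) * ((Real.cos θ : ℝ) : ℂ)))
    (hα : ∀ f p, α f p = ah f p.1 * av f p.2)
    (Rh : Matrix (Fin Nh) (Fin Nh) ℂ) (Rv : Matrix (Fin Nv) (Fin Nv) ℂ)
    (hRh : Rh = Matrix.diagonal (fun k : Fin Nh =>
      Complex.exp (2 * (Real.pi : ℂ) * Complex.I * ((lh * (fd - fu) / c : ℝ) : ℂ) *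
        ((k : ℕ) : ℂ) * ((Real.cos θ : ℝ) : ℂ) * ((Real.cos φ : ℝ) : ℂ))))
    (hRv : Rv = Matrix.diagonal (fun k : Fin Nv =>
      Complex.exp (2 * (Real.pi : ℂ) * Complex.I * ((lv * (fd - fu) / c : ℝ) : ℂ) *
        ((k : ℕ) : ℂ) * ((Real.cos θ : ℝ) : ℂ)))) :
    α fd = (Rh ⊗ₖ Rv).mulVec (α fu) := by
  funext p
  rw [hRh, hRv, Matrix.diagonal_kronecker_diagonal, Matrix.mulVec_diagonal, hα, hα, hah, hah,
    hav, hav, ← Complex.exp_add, ← Complex.exp_add, ← Complex.exp_add, ← Complex.exp_add]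
  congr 1
  push_cast
  ring
end

section
/- Let M, L, N_L be positive integers with M ≤ L ≤ N_L − M. Let z_1,…,z_M ∈ ℂ be pairwise distinct and a_1,…,a_M ∈ ℂ be nonzero. Define Z_1 ∈ ℂ^{(N_L−L)×M} with (k,m) entry z_m^{k} for k = 0,…,N_L−L−1, Z_2 ∈ ℂ^{M×L} with (m,l) entry z_m^{L−1−l} for l = 0,…,L−1, Z_0 = diag(z_1,…,z_M), A = diag(a_1,…,a_M), and the prediction matrices P_0 = Z_1·A·Z_2 and P_1 = Z_1·A·Z_0·Z_2. Then for every m ∈ {1,…,M} there exists x ∈ ℂ^{L} such that P_0·x ≠ 0 and P_1·x = z_m·(P_0·x); that is, each pole z_m is a generalized eigenvalue of the matrix pencil (P_1, P_0). -/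
open Matrix Complex

/-- one direction of Lemma 1, Matrix Pencil: each pole `z_m` is a
generalized eigenvalue of the pencil `(P_1, P_0)`. -/
theorem stmt_9 (M L NL : ℕ) (hM : 0 < M) (hL : 0 < L) (hNL : 0 < NL)
    (hML : M ≤ L) (hLN : L ≤ NL - M)
    (z : Fin M → ℂ) (hz : Function.Injective z)
    (a : Fin M → ℂ) (ha : ∀ m, a m ≠ 0)
    (Z1 : Matrix (Fin (NL - L)) (Fin M) ℂ)
    (hZ1 : ∀ (k : Fin (NL - L)) (m : Fin M), Z1 k m = z m ^ (k : ℕ))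
    (Z2 : Matrix (Fin M) (Fin L) ℂ)
    (hZ2 : ∀ (m : Fin M) (l : Fin L), Z2 m l = z m ^ (L - 1 - (l : ℕ)))
    (Z0 : Matrix (Fin M) (Fin M) ℂ) (hZ0 : Z0 = Matrix.diagonal z)
    (A : Matrix (Fin M) (Fin M) ℂ) (hA : A = Matrix.diagonal a)
    (P0 P1 : Matrix (Fin (NL - L)) (Fin L) ℂ)
    (hP0 : P0 = Z1 * A * Z2) (hP1 : P1 = Z1 * A * Z0 * Z2) :
    ∀ m : Fin M, ∃ x : Fin L → ℂ,
      P0.mulVec x ≠ 0 ∧ P1.mulVec x = z m • P0.mulVec x := by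
  intro m
  subst hZ0 hA hP0 hP1
  set p : Polynomial ℂ := Lagrange.basis Finset.univ z m with hp
  have hdeg : p.natDegree < L := by
    have h := Lagrange.degree_basis (s := Finset.univ) (v := z) hz.injOn (Finset.mem_univ m)
    have h2 := Polynomial.natDegree_eq_of_degree_eq_some h
    rw [Finset.card_univ, Fintype.card_fin] at h2
    rw [hp, h2]
    omega
  have hx : Z2.mulVec (fun l : Fin L => p.coeff (L - 1 - (l : ℕ))) = Pi.single m 1 := by
    ext i
    have h1 : Z2.mulVec (fun l : Fin L => p.coeff (L - 1 - (l : ℕ))) i = p.eval (z i) := by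
      rw [Polynomial.eval_eq_sum_range' hdeg, ← Finset.sum_range_reflect,
        Finset.sum_range, Matrix.mulVec, dotProduct]
      refine Finset.sum_congr rfl fun l _ => ?_
      rw [hZ2, mul_comm]
    rw [h1]
    by_cases h : i = m
    · subst h
      rw [Pi.single_eq_same]
      exact Lagrange.eval_basis_self hz.injOn (Finset.mem_univ i)
    · rw [Pi.single_eq_of_ne h]
      exact Lagrange.eval_basis_of_ne (Ne.symm h) (Finset.mem_univ i)
  have h0 : ∀ c : ℂ, (Matrix.diagonal a).mulVec (Pi.single m c) = Pi.single m (a m * c) := by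
    intro c
    exact Matrix.diagonal_mulVec_single a m c
  refine ⟨fun l : Fin L => p.coeff (L - 1 - (l : ℕ)), ?_, ?_⟩
  · rw [← Matrix.mulVec_mulVec, hx, ← Matrix.mulVec_mulVec, h0]
    intro h
    have h3 := congrFun h ⟨0, by omega⟩
    rw [Matrix.mulVec_single] at h3
    simp [hZ1, ha] at h3
  · simp only [← Matrix.mulVec_mulVec]
    rw [hx, Matrix.diagonal_mulVec_single, h0, h0, ← Matrix.mulVec_smul]
    congr 1
    rw [← Pi.single_smul]
    congr 1
    simp [mul_comm]
end

section
/- Let M, L, N_L be positive integers with M ≤ L ≤ N_L − M. Let z_1,…,z_M ∈ ℂ be pairwise distinct and a_1,…,a_M ∈ ℂ be nonzero. Define Z_1 ∈ ℂ^{(N_L−L)×M} with (k,m) entry z_m^{k} for k = 0,…,N_L−L−1, Z_2 ∈ ℂ^{M×L} with (m,l) entry z_m^{L−1−l} for l = 0,…,L−1, Z_0 = diag(z_1,…,z_M), A = diag(a_1,…,a_M), and P_0 = Z_1·A·Z_2, P_1 = Z_1·A·Z_0·Z_2. If z ∈ ℂ and x ∈ ℂ^{L} satisfy P_0·x ≠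 0 and P_1·x = z·(P_0·x), then z ∈ {z_1,…,z_M}; that is, every generalized eigenvalue of the pencil (P_1, P_0) is one of the poles z_m. -/
open Matrix Complex

/-- converse direction of Lemma 1, Matrix Pencil: every generalized
eigenvalue of the pencil `(P_1, P_0)` is one of the poles `z_m`. -/
theorem stmt_10 (M L NL : ℕ) (hM : 0 < M) (hL : 0 < L) (hNL : 0 < NL)
    (hML : M ≤ L) (hLN : L ≤ NL - M)
    (z : Fin M → ℂ) (hz : Function.Injective z)
    (a : Fin M → ℂ) (ha : ∀ m, a m ≠ 0)
    (Z1 : Matrix (Fin (NL - L)) (Fin M) ℂ)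
    (hZ1 : ∀ (k : Fin (NL - L)) (m : Fin M), Z1 k m = z m ^ (k : ℕ))
    (Z2 : Matrix (Fin M) (Fin L) ℂ)
    (hZ2 : ∀ (m : Fin M) (l : Fin L), Z2 m l = z m ^ (L - 1 - (l : ℕ)))
    (Z0 : Matrix (Fin M) (Fin M) ℂ) (hZ0 : Z0 = Matrix.diagonal z)
    (A : Matrix (Fin M) (Fin M) ℂ) (hA : A = Matrix.diagonal a)
    (P0 P1 : Matrix (Fin (NL - L)) (Fin L) ℂ)
    (hP0 : P0 = Z1 * A * Z2) (hP1 : P1 = Z1 * A * Z0 * Z2) :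
    ∀ (w : ℂ) (x : Fin L → ℂ),
      P0.mulVec x ≠ 0 → P1.mulVec x = w • P0.mulVec x → ∃ m : Fin M, w = z m := by
  intro w x hx h
  by_contra hne
  push Not at hne
  apply hx
  subst hP0 hP1 hZ0 hA
  have hMN : M ≤ NL - L := by omega
  have key : (fun m => a m * (z m - w) * (Z2 *ᵥ x) m) = 0 := by
    apply Matrix.eq_zero_of_forall_pow_sum_mul_pow_eq_zero hz
    intro i
    have hi := congrFun h (Fin.castLE hMN i)
    simp only [← Matrix.mulVec_mulVec, Pi.smul_apply, smul_eq_mul] at hi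
    generalize Z2 *ᵥ x = y at hi ⊢
    have hz1 : ∀ v : Fin M → ℂ, (Z1 *ᵥ v) (Fin.castLE hMN i) = ∑ m, z m ^ (i : ℕ) * v m := by
      intro v
      simp [Matrix.mulVec, dotProduct, hZ1]
    simp only [hz1, Matrix.mulVec_diagonal] at hi
    rw [← sub_eq_zero, Finset.mul_sum, ← Finset.sum_sub_distrib] at hi
    rw [← hi]
    refine Finset.sum_congr rfl fun m _ => ?_
    ring
  have hy : Z2 *ᵥ x = 0 := by
    funext m
    have hm := congrFun key m
    simp only [Pi.zero_apply, mul_eq_zero, ha m, sub_eq_zero, false_or] at hm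
    rcases hm with hm | hm
    · exact absurd hm.symm (hne m)
    · exact hm
  rw [← Matrix.mulVec_mulVec, hy, Matrix.mulVec_zero]
end

section
/- For a positive integer N and x ∈ ℝ, let v_N(x) ∈ ℂ^{N} be the vector with k-th entry exp(i·k·x) for k = 0,…,N−1. For p ∈ {1,2}, let t_p, x_p, y_p ∈ ℝ and define r_p(N_f, N_h, N_v) = v_{N_f}(t_p) ⊗ v_{N_h}(x_p) ⊗ v_{N_v}(y_p) ∈ ℂ^{N_f N_h N_v}. (a) If at least one of exp(i(t_1−t_2)) ≠ 1, exp(i(x_1−x_2)) ≠ 1, exp(i(y_1−y_2)) ≠ 1 holds, then (r_1(N_f,N_h,N_v))ᴴ · r_2(N_f,N_h,N_v) / (N_f·N_h·N_v) tends to 0 as (N_f, N_h, N_v) → (∞, ∞, ∞) (along the product of the atTop filters on ℕ³). (b) If exp(i(t_1−t_2)) = exp(i(x_1−x_2)) = exp(i(y_1−y_2)) = 1, then (r_1)ᴴ·r_2 / (N_f·N_h·N_v) = 1 for all N_f, N_h, N_v. -/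
open Complex Filter Matrix

/-- The vector `v_N(x) ∈ ℂ^N` with `k`-th entry `exp(i k x)`. -/
noncomputable def expVec (N : ℕ) (x : ℝ) : Fin N → ℂ :=
  fun k => Complex.exp (Complex.I * ((k : ℕ) : ℂ) * (x : ℂ))

/-- The angle-delay structure `v_{N_f}(t) ⊗ v_{N_h}(x) ⊗ v_{N_v}(y)`. -/
noncomputable def adStructure (Nf Nh Nv : ℕ) (t x y : ℝ) :
    (Fin Nf × Fin Nh × Fin Nv) → ℂ :=
  fun p => expVec Nf t p.1 * expVec Nh x p.2.1 * expVec Nv y p.2.2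

/-- One-dimensional inner product as a geometric sum. -/
noncomputable def geoS (a b : ℝ) (N : ℕ) : ℂ :=
  ∑ k ∈ Finset.range N, (Complex.exp (Complex.I * ((b - a : ℝ) : ℂ))) ^ k

theorem expVec_ip (a b : ℝ) (N : ℕ) :
    ∑ k : Fin N, star (expVec N a k) * expVec N b k = geoS a b N := by
  unfold geoS
  rw [Finset.sum_range]
  refine Finset.sum_congr rfl fun k _ => ?_
  simp only [expVec]
  rw [Complex.star_def, ← Complex.exp_conj, ← Complex.exp_add, ← Complex.exp_nat_mul]
  congr 1
  simp only [map_mul, Complex.conj_I, Complex.conj_ofReal, map_natCast]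
  push_cast
  ring

theorem ad_ip (Nf Nh Nv : ℕ) (t₁ t₂ x₁ x₂ y₁ y₂ : ℝ) :
    (star (adStructure Nf Nh Nv t₁ x₁ y₁) ⬝ᵥ adStructure Nf Nh Nv t₂ x₂ y₂) /
      ((Nf * Nh * Nv : ℕ) : ℂ) =
    (geoS t₁ t₂ Nf / Nf) * ((geoS x₁ x₂ Nh / Nh) * (geoS y₁ y₂ Nv / Nv)) := by
  have h : star (adStructure Nf Nh Nv t₁ x₁ y₁) ⬝ᵥ adStructure Nf Nh Nv t₂ x₂ y₂ =
      geoS t₁ t₂ Nf * (geoS x₁ x₂ Nh * geoS y₁ y₂ Nv) := by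
    rw [← expVec_ip, ← expVec_ip, ← expVec_ip, Finset.sum_mul_sum, Finset.sum_mul_sum]
    simp only [dotProduct, Fintype.sum_prod_type,
      adStructure, Pi.star_apply, star_mul', Finset.mul_sum]
    refine Finset.sum_congr rfl fun i _ => Finset.sum_congr rfl fun j _ =>
      Finset.sum_congr rfl fun k _ => ?_
    ring
  rw [h]
  push_cast
  rw [div_mul_div_comm, div_mul_div_comm, mul_assoc (Nf : ℂ)]

theorem exp_swap (a b : ℝ) : Complex.exp (Complex.I * ((b - a : ℝ) : ℂ)) =
    (Complex.exp (Complex.I * ((a - b : ℝ) : ℂ)))⁻¹ := by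
  rw [← Complex.exp_neg]
  congr 1
  push_cast
  ring

theorem norm_exp_one (a : ℝ) : ‖Complex.exp (Complex.I * (a : ℂ))‖ = 1 := by
  rw [mul_comm]
  exact Complex.norm_exp_ofReal_mul_I a

theorem geoS_bound (a b : ℝ) (N : ℕ) : ‖geoS a b N / N‖ ≤ 1 := by
  rw [norm_div, Complex.norm_natCast]
  refine div_le_one_of_le₀ ?_ (Nat.cast_nonneg N)
  refine (norm_sum_le _ _).trans ?_
  simp [norm_pow, norm_exp_one, -Complex.ofReal_sub]

theorem geoS_one (a b : ℝ) (h : Complex.exp (Complex.I * ((a - b : ℝ) : ℂ)) = 1)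
    (N : ℕ) (hN : 0 < N) : geoS a b N / N = 1 := by
  have : (N : ℂ) ≠ 0 := by exact_mod_cast hN.ne'
  unfold geoS
  rw [exp_swap, h]
  simp [this]

theorem geoS_tendsto (a b : ℝ) (h : Complex.exp (Complex.I * ((a - b : ℝ) : ℂ)) ≠ 1) :
    Tendsto (fun N : ℕ => geoS a b N / N) atTop (nhds 0) := by
  have h' : Complex.exp (Complex.I * ((b - a : ℝ) : ℂ)) ≠ 1 := by
    rw [exp_swap]
    simpa only [ne_eq, inv_eq_one] using h
  refine squeeze_zero_norm (a := fun N : ℕ =>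
    (2 / ‖Complex.exp (Complex.I * ((b - a : ℝ) : ℂ)) - 1‖) / (N : ℝ)) (fun N => ?_)
    (tendsto_const_div_atTop_nhds_zero_nat _)
  rw [norm_div, Complex.norm_natCast]
  unfold geoS
  rw [geom_sum_eq h', norm_div]
  gcongr
  refine (norm_sub_le _ _).trans ?_
  rw [norm_pow, norm_exp_one]
  norm_num

theorem bdd_mul_tendsto {l : Filter (ℕ × ℕ × ℕ)} (f g : ℕ × ℕ × ℕ → ℂ)
    (hf : Tendsto f l (nhds 0)) (hg : ∀ p, ‖g p‖ ≤ 1) :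
    Tendsto (fun p => f p * g p) l (nhds 0) := by
  refine squeeze_zero_norm (fun p => ?_) (tendsto_zero_iff_norm_tendsto_zero.1 hf)
  rw [norm_mul]
  exact mul_le_of_le_one_right (norm_nonneg _) (hg p)

/-- asymptotic orthogonality of the angle-delay structures of two paths
(used in the proof of Theorem 2 of the paper): the normalized inner product
`r₁ᴴ r₂ / (N_f N_h N_v)` tends to `0` as the dimensions grow unless the two paths
share an identical angle-delay structure, in which case it equals `1`. -/
theorem stmt_13 (t₁ t₂ x₁ x₂ y₁ y₂ : ℝ) :
    ((Complex.exp (Complex.I * ((t₁ - t₂ : ℝ) : ℂ)) ≠ 1 ∨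
      Complex.exp (Complex.I * ((x₁ - x₂ : ℝ) : ℂ)) ≠ 1 ∨
      Complex.exp (Complex.I * ((y₁ - y₂ : ℝ) : ℂ)) ≠ 1) →
      Tendsto (fun p : ℕ × ℕ × ℕ =>
          (star (adStructure p.1 p.2.1 p.2.2 t₁ x₁ y₁) ⬝ᵥ
              adStructure p.1 p.2.1 p.2.2 t₂ x₂ y₂) /
            ((p.1 * p.2.1 * p.2.2 : ℕ) : ℂ))
        ((atTop : Filter ℕ) ×ˢ ((atTop : Filter ℕ) ×ˢ (atTop : Filter ℕ)))
        (nhds 0)) ∧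
    ((Complex.exp (Complex.I * ((t₁ - t₂ : ℝ) : ℂ)) = 1 ∧
      Complex.exp (Complex.I * ((x₁ - x₂ : ℝ) : ℂ)) = 1 ∧
      Complex.exp (Complex.I * ((y₁ - y₂ : ℝ) : ℂ)) = 1) →
      ∀ Nf Nh Nv : ℕ, 0 < Nf → 0 < Nh → 0 < Nv →
        (star (adStructure Nf Nh Nv t₁ x₁ y₁) ⬝ᵥ adStructure Nf Nh Nv t₂ x₂ y₂) /
            ((Nf * Nh * Nv : ℕ) : ℂ) = 1) := by
  constructor
  · intro h
    simp only [ad_ip]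
    rcases h with h | h | h
    · refine bdd_mul_tendsto _ _ ((geoS_tendsto _ _ h).comp tendsto_fst) fun p => ?_
      rw [norm_mul]
      exact mul_le_one₀ (geoS_bound _ _ _) (norm_nonneg _) (geoS_bound _ _ _)
    · have := bdd_mul_tendsto _ (fun p => (geoS t₁ t₂ p.1 / p.1) * (geoS y₁ y₂ p.2.2 / p.2.2))
        ((geoS_tendsto _ _ h).comp ((tendsto_fst (f := (atTop : Filter ℕ))
          (g := (atTop : Filter ℕ))).comp
          (tendsto_snd (f := (atTop : Filter ℕ))))) fun p => by
            rw [norm_mul]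
            exact mul_le_one₀ (geoS_bound _ _ _) (norm_nonneg _) (geoS_bound _ _ _)
      refine this.congr fun p => ?_
      simp only [Function.comp]
      ring
    · have := bdd_mul_tendsto _ (fun p => (geoS t₁ t₂ p.1 / p.1) * (geoS x₁ x₂ p.2.1 / p.2.1))
        ((geoS_tendsto _ _ h).comp ((tendsto_snd (f := (atTop : Filter ℕ))
          (g := (atTop : Filter ℕ))).comp
          (tendsto_snd (f := (atTop : Filter ℕ))))) fun p => by
            rw [norm_mul]
            exact mul_le_one₀ (geoS_bound _ _ _) (norm_nonneg _) (geoS_bound _ _ _)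
      refine this.congr fun p => ?_
      simp only [Function.comp]
      ring
  · rintro ⟨h1, h2, h3⟩ Nf Nh Nv hf hh hv
    rw [ad_ip, geoS_one _ _ h1 _ hf, geoS_one _ _ h2 _ hh, geoS_one _ _ h3 _ hv]
    norm_num
end
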